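/- (Attainment of the attacker's worst-case optimum by a Markov policy.) In a finite-horizon two-player Markov game with base attacker Markov policies π₂¹, …, π₂ᴷ and belief set Δ(Π), define V*_{1,h}(s) := max_{π₁∈Π₁} min_{π₂∈Δ(Π)} V^{π₁,π₂}_{1,h}(s); Π₁* := {π₁ ∈ Π₁ : min_{π₂∈Δ(Π)} V^{π₁,π₂}_{1,h}(s) = V*_{1,h}(s) for all h, s}; and V*_{2,h}(s) := max_{π₂∈Π₂} min_{π₁∈Π₁*} V^{π₁,π₂}_{2,h}(s). Then there exists an attacker Markov policy π₂* such that for every h ∈ [H] and s ∈ S simultaneously, min_{π₁∈Π₁*} V^{π₁,π₂*}_{2,h}(s) = V*_{2,h}(s). -/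

import Mathlib

open Finset

noncomputable section

/-- Value with `t` steps to go (time step `h = H + 1 - t`, 1-based), defined by the
backward recursion `V_{H+1} = 0`,
`V_h(s) = Σ_{a₁,a₂} π₁ₕ(s)(a₁) π₂ₕ(s)(a₂) [R_h(s,a₁,a₂) + Σ_{s'} P_h(s'|s,a₁,a₂) V_{h+1}(s')]`. -/
def valAux {S : Type} [Fintype S] {n m : ℕ} (H : ℕ)
    (R : ℕ → S → Fin n → Fin m → ℝ) (P : ℕ → S → Fin n → Fin m → S → ℝ)
    (π1 : ℕ → S → Fin n → ℝ) (π2 : ℕ → S → Fin m → ℝ) : ℕ → S → ℝ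
  | 0, _ => 0
  | t + 1, s =>
      ∑ a1, ∑ a2, π1 (H - t) s a1 * π2 (H - t) s a2 *
        (R (H - t) s a1 a2 + ∑ s', P (H - t) s a1 a2 s' * valAux H R P π1 π2 t s')

/-- The value `V^{π₁,π₂}_h(s)` at (1-based) time step `h ∈ [H+1]`. -/
def Vfun {S : Type} [Fintype S] {n m : ℕ} (H : ℕ)
    (R : ℕ → S → Fin n → Fin m → ℝ) (P : ℕ → S → Fin n → Fin m → S → ℝ)
    (π1 : ℕ → S → Fin n → ℝ) (π2 : ℕ → S → Fin m → ℝ) (h : ℕ) (s : S) : ℝ :=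
  valAux H R P π1 π2 (H + 1 - h) s

/-- The set of Markov policies over action set `[n]`. -/
def polSet (S : Type) (n : ℕ) : Set (ℕ → S → Fin n → ℝ) :=
  {π | ∀ h s, π h s ∈ stdSimplex ℝ (Fin n)}

/-- The belief set `Δ(Π)`: all attacker Markov policies that are, at every stage and
state, a convex combination of the base policies `π₂¹, …, π₂ᴷ`. -/
def beliefSet (S : Type) {m K : ℕ} (base : Fin K → ℕ → S → Fin m → ℝ) :
    Set (ℕ → S → Fin m → ℝ) :=
  {π | ∀ h s, ∃ p ∈ stdSimplex ℝ (Fin K), ∀ a2, π h s a2 = ∑ k, p k * base k h s a2}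

/-- `P` is a transition kernel: each `P_h(·|s,a₁,a₂)` is a probability distribution. -/
def isKernel (S : Type) [Fintype S] {n m : ℕ} (P : ℕ → S → Fin n → Fin m → S → ℝ) : Prop :=
  ∀ h s a1 a2, (fun s' => P h s a1 a2 s') ∈ stdSimplex ℝ S

/-- The victim's optimal worst-case value `V*_{1,h}(s) = max_{π₁} min_{π₂∈Δ(Π)} V^{π₁,π₂}_{1,h}(s)`. -/
def Vstar1 {S : Type} [Fintype S] {n m K : ℕ} (H : ℕ)
    (R1 : ℕ → S → Fin n → Fin m → ℝ) (P : ℕ → S → Fin n → Fin m → S → ℝ)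
    (base : Fin K → ℕ → S → Fin m → ℝ) (h : ℕ) (s : S) : ℝ :=
  sSup ((fun π1 => sInf ((fun π2 => Vfun H R1 P π1 π2 h s) '' beliefSet S base)) '' polSet S n)

/-- The set `Π₁*` of victim policies that achieve the optimal worst-case value
`V*_{1,h}(s)` simultaneously at every `h ∈ [H]` and `s ∈ S`. -/
def Pi1starSet {S : Type} [Fintype S] {n m K : ℕ} (H : ℕ)
    (R1 : ℕ → S → Fin n → Fin m → ℝ) (P : ℕ → S → Fin n → Fin m → S → ℝ)
    (base : Fin K → ℕ → S → Fin m → ℝ) : Set (ℕ → S → Fin n → ℝ) :=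
  {π1 ∈ polSet S n | ∀ h : ℕ, 1 ≤ h → h ≤ H → ∀ s : S,
    sInf ((fun π2 => Vfun H R1 P π1 π2 h s) '' beliefSet S base) = Vstar1 H R1 P base h s}

/-- The attacker's optimal worst-case value
`V*_{2,h}(s) = max_{π₂∈Π₂} min_{π₁∈Π₁*} V^{π₁,π₂}_{2,h}(s)`. -/
def Vstar2 {S : Type} [Fintype S] {n m K : ℕ} (H : ℕ)
    (R1 R2 : ℕ → S → Fin n → Fin m → ℝ) (P : ℕ → S → Fin n → Fin m → S → ℝ)
    (base : Fin K → ℕ → S → Fin m → ℝ) (h : ℕ) (s : S) : ℝ :=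
  sSup ((fun π2 => sInf ((fun π1 => Vfun H R2 P π1 π2 h s) '' Pi1starSet H R1 P base)) ''
    polSet S m)

/-- One-step Bellman evaluation: mixed actions `p`, `q` are played at stage `h` and state `s`,
and the continuation value is `v`. -/
def bellman {S : Type} [Fintype S] {n m : ℕ}
    (R : ℕ → S → Fin n → Fin m → ℝ) (P : ℕ → S → Fin n → Fin m → S → ℝ)
    (h : ℕ) (s : S) (p : Fin n → ℝ) (q : Fin m → ℝ) (v : S → ℝ) : ℝ :=
  ∑ a1, ∑ a2, p a1 * q a2 * (R h s a1 a2 + ∑ s', P h s a1 a2 s' * v s')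

lemma bellman_mono {S : Type} [Fintype S] {n m : ℕ}
    (R : ℕ → S → Fin n → Fin m → ℝ) {P : ℕ → S → Fin n → Fin m → S → ℝ} (hP : isKernel S P)
    (h : ℕ) (s : S) {p : Fin n → ℝ} (hp : p ∈ stdSimplex ℝ (Fin n))
    {q : Fin m → ℝ} (hq : q ∈ stdSimplex ℝ (Fin m)) {v w : S → ℝ} (hvw : v ≤ w) :
    bellman R P h s p q v ≤ bellman R P h s p q w := by
  refine sum_le_sum fun a1 _ => sum_le_sum fun a2 _ => ?_
  refine mul_le_mul_of_nonneg_left ?_ (mul_nonneg (hp.1 a1) (hq.1 a2))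
  gcongr with s'
  · exact (hP h s a1 a2).1 s'
  · exact hvw s'

lemma bellman_add_const {S : Type} [Fintype S] {n m : ℕ}
    (R : ℕ → S → Fin n → Fin m → ℝ) {P : ℕ → S → Fin n → Fin m → S → ℝ} (hP : isKernel S P)
    (h : ℕ) (s : S) {p : Fin n → ℝ} (hp : p ∈ stdSimplex ℝ (Fin n))
    {q : Fin m → ℝ} (hq : q ∈ stdSimplex ℝ (Fin m)) (v : S → ℝ) (c : ℝ) :
    bellman R P h s p q (fun s' => v s' + c) = bellman R P h s p q v + c := by
  have hk : ∀ a1 a2, ∑ s', P h s a1 a2 s' * (v s' + c)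
      = ∑ s', P h s a1 a2 s' * v s' + c := by
    intro a1 a2
    simp only [mul_add, sum_add_distrib, ← sum_mul]
    rw [show ∑ s', P h s a1 a2 s' = 1 from (hP h s a1 a2).2, one_mul]
  have hpq : ∑ a1, ∑ a2, p a1 * q a2 * c = c := by
    simp only [← sum_mul, ← mul_sum]
    rw [hp.2, hq.2, one_mul, one_mul]
  unfold bellman
  simp only [hk, ← add_assoc]
  simp only [mul_add _ _ c, sum_add_distrib]
  rw [hpq]

lemma neg_sum_abs_le_bellman {S : Type} [Fintype S] {n m : ℕ}
    (R : ℕ → S → Fin n → Fin m → ℝ) (P : ℕ → S → Fin n → Fin m → S → ℝ)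
    (h : ℕ) (s : S) {p : Fin n → ℝ} (hp : p ∈ stdSimplex ℝ (Fin n))
    {q : Fin m → ℝ} (hq : q ∈ stdSimplex ℝ (Fin m)) (v : S → ℝ) :
    -∑ a1, ∑ a2, |R h s a1 a2 + ∑ s', P h s a1 a2 s' * v s'| ≤ bellman R P h s p q v := by
  simp only [← sum_neg_distrib]
  refine sum_le_sum fun a1 _ => sum_le_sum fun a2 _ => ?_
  set c := R h s a1 a2 + ∑ s', P h s a1 a2 s' * v s'
  have h0 : 0 ≤ p a1 * q a2 := mul_nonneg (hp.1 a1) (hq.1 a2)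
  have h1 : p a1 * q a2 ≤ 1 :=
    mul_le_one₀ (mem_Icc_of_mem_stdSimplex hp a1).2 (hq.1 a2) (mem_Icc_of_mem_stdSimplex hq a2).2
  have h2 := neg_abs_le c
  have h3 := abs_nonneg c
  nlinarith

lemma continuous_bellman_right {S : Type} [Fintype S] {n m : ℕ}
    (R : ℕ → S → Fin n → Fin m → ℝ) (P : ℕ → S → Fin n → Fin m → S → ℝ)
    (h : ℕ) (s : S) (p : Fin n → ℝ) (v : S → ℝ) :
    Continuous fun q : Fin m → ℝ => bellman R P h s p q v := by
  unfold bellman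
  fun_prop

/-- A one-step operator which is monotone, commutes with adding constants and is bounded below
over the nonempty sets `X h s` of admissible actions. -/
structure IsRobustOperator {S A : Type} (T : ℕ → S → A → (S → ℝ) → ℝ)
    (X : ℕ → S → Set A) : Prop where
  nonempty : ∀ h s, (X h s).Nonempty
  mono : ∀ h s, ∀ a ∈ X h s, ∀ v w : S → ℝ, v ≤ w → T h s a v ≤ T h s a w
  add_const : ∀ h s, ∀ a ∈ X h s, ∀ (v : S → ℝ) (c : ℝ),
    T h s a (fun s' => v s' + c) = T h s a v + c
  bddBelow : ∀ h s v, BddBelow ((fun a => T h s a v) '' X h s)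

/-- Value of the policy `x` with `t` steps to go. -/
def policyVal {S A : Type} (T : ℕ → S → A → (S → ℝ) → ℝ) (H : ℕ) (x : ℕ → S → A) : ℕ → S → ℝ
  | 0, _ => 0
  | t + 1, s => T (H - t) s (x (H - t) s) (policyVal T H x t)

/-- Worst-case value with `t` steps to go, by dynamic programming. -/
def robustVal {S A : Type} (T : ℕ → S → A → (S → ℝ) → ℝ) (H : ℕ) (X : ℕ → S → Set A) :
    ℕ → S → ℝ
  | 0, _ => 0
  | t + 1, s => sInf ((fun a => T (H - t) s a (robustVal T H X t)) '' X (H - t) s)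

lemma robustVal_le_policyVal {S A : Type} {T : ℕ → S → A → (S → ℝ) → ℝ} {X : ℕ → S → Set A}
    (hT : IsRobustOperator T X) (H : ℕ) {x : ℕ → S → A} (hx : ∀ h s, x h s ∈ X h s) (t : ℕ) :
    robustVal T H X t ≤ policyVal T H x t := by
  induction t with
  | zero => exact fun s => le_rfl
  | succ t ih =>
    intro s
    exact (csInf_le (hT.bddBelow _ _ _) ⟨_, hx _ _, rfl⟩).trans (hT.mono _ _ _ (hx _ _) _ _ ih)

lemma exists_policyVal_le_robustVal_add {S A : Type} {T : ℕ → S → A → (S → ℝ) → ℝ}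
    {X : ℕ → S → Set A} (hT : IsRobustOperator T X) (H : ℕ) {ε : ℝ} (hε : 0 < ε) :
    ∃ x : ℕ → S → A, (∀ h s, x h s ∈ X h s) ∧
      ∀ t ≤ H, ∀ s, policyVal T H x t s ≤ robustVal T H X t s + t * ε := by
  have hsel : ∀ h s, ∃ a ∈ X h s, T h s a (robustVal T H X (H - h)) <
      sInf ((fun a => T h s a (robustVal T H X (H - h))) '' X h s) + ε := by
    intro h s
    obtain ⟨_, ⟨a, ha, rfl⟩, hlt⟩ := exists_lt_of_csInf_lt
      ((hT.nonempty h s).image fun a => T h s a (robustVal T H X (H - h)))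
      (lt_add_of_pos_right _ hε)
    exact ⟨a, ha, hlt⟩
  choose x hx hlt using hsel
  refine ⟨x, hx, fun t => ?_⟩
  induction t with
  | zero => intro _ s; simp [policyVal, robustVal]
  | succ t ih =>
    intro ht s
    have h1 := hT.mono (H - t) s _ (hx (H - t) s) _
      (fun s' => robustVal T H X t s' + t * ε) (ih (by omega))
    rw [hT.add_const _ _ _ (hx _ _)] at h1
    have h2 := hlt (H - t) s
    rw [show H - (H - t) = t by omega] at h2
    simp only [policyVal, robustVal]
    push_cast
    linarith

lemma sInf_policyVal_eq_robustVal {S A : Type} {T : ℕ → S → A → (S → ℝ) → ℝ}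
    {X : ℕ → S → Set A} (hT : IsRobustOperator T X) {H t : ℕ} (ht : t ≤ H) (s : S) :
    sInf ((fun x => policyVal T H x t s) '' {x | ∀ h s, x h s ∈ X h s}) = robustVal T H X t s := by
  have hlb : ∀ y ∈ (fun x => policyVal T H x t s) '' {x | ∀ h s, x h s ∈ X h s},
      robustVal T H X t s ≤ y := by
    rintro _ ⟨x, hx, rfl⟩
    exact robustVal_le_policyVal hT H hx t s
  refine le_antisymm (le_of_forall_pos_le_add fun δ hδ => ?_) (le_csInf ?_ hlb)
  · obtain ⟨x, hx, hle⟩ := exists_policyVal_le_robustVal_add hT H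
      (show 0 < δ / (t + 1) by positivity)
    refine (csInf_le ⟨_, hlb⟩ ⟨x, hx, rfl⟩).trans ((hle t ht s).trans ?_)
    have : (t : ℝ) * (δ / (t + 1)) ≤ δ := by
      rw [mul_div_assoc', div_le_iff₀ (by positivity)]
      nlinarith
    linarith
  · choose x hx using hT.nonempty
    exact ⟨_, x, hx, rfl⟩

lemma valAux_eq_policyVal_left {S : Type} [Fintype S] {n m : ℕ} (H : ℕ)
    (R : ℕ → S → Fin n → Fin m → ℝ) (P : ℕ → S → Fin n → Fin m → S → ℝ)
    (π1 : ℕ → S → Fin n → ℝ) (π2 : ℕ → S → Fin m → ℝ) (t : ℕ) :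
    valAux H R P π1 π2 t
      = policyVal (fun h s p v => bellman R P h s p (π2 h s) v) H π1 t := by
  induction t with
  | zero => rfl
  | succ t ih => funext s; simp only [valAux, policyVal, bellman, ih]

lemma valAux_eq_policyVal_right {S : Type} [Fintype S] {n m : ℕ} (H : ℕ)
    (R : ℕ → S → Fin n → Fin m → ℝ) (P : ℕ → S → Fin n → Fin m → S → ℝ)
    (π1 : ℕ → S → Fin n → ℝ) (π2 : ℕ → S → Fin m → ℝ) (t : ℕ) :
    valAux H R P π1 π2 t
      = policyVal (fun h s q v => bellman R P h s (π1 h s) q v) H π2 t := by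
  induction t with
  | zero => rfl
  | succ t ih => funext s; simp only [valAux, policyVal, bellman, ih]

lemma isRobustOperator_left {S : Type} [Fintype S] {n m : ℕ}
    (R : ℕ → S → Fin n → Fin m → ℝ) {P : ℕ → S → Fin n → Fin m → S → ℝ} (hP : isKernel S P)
    {π2 : ℕ → S → Fin m → ℝ} (hπ2 : π2 ∈ polSet S m) {X : ℕ → S → Set (Fin n → ℝ)}
    (hne : ∀ h s, (X h s).Nonempty) (hX : ∀ h s, X h s ⊆ stdSimplex ℝ (Fin n)) :
    IsRobustOperator (fun h s p v => bellman R P h s p (π2 h s) v) X where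
  nonempty := hne
  mono h s _ hp _ _ := bellman_mono R hP h s (hX h s hp) (hπ2 h s)
  add_const h s _ hp := bellman_add_const R hP h s (hX h s hp) (hπ2 h s)
  bddBelow h s v := ⟨_, Set.forall_mem_image.2 fun _ hp =>
    neg_sum_abs_le_bellman R P h s (hX h s hp) (hπ2 h s) v⟩

lemma isRobustOperator_right {S : Type} [Fintype S] {n m : ℕ}
    (R : ℕ → S → Fin n → Fin m → ℝ) {P : ℕ → S → Fin n → Fin m → S → ℝ} (hP : isKernel S P)
    {π1 : ℕ → S → Fin n → ℝ} (hπ1 : π1 ∈ polSet S n) {X : ℕ → S → Set (Fin m → ℝ)}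
    (hne : ∀ h s, (X h s).Nonempty) (hX : ∀ h s, X h s ⊆ stdSimplex ℝ (Fin m)) :
    IsRobustOperator (fun h s q v => bellman R P h s (π1 h s) q v) X where
  nonempty := hne
  mono h s _ hq _ _ := bellman_mono R hP h s (hπ1 h s) (hX h s hq)
  add_const h s _ hq := bellman_add_const R hP h s (hπ1 h s) (hX h s hq)
  bddBelow h s v := ⟨_, Set.forall_mem_image.2 fun _ hq =>
    neg_sum_abs_le_bellman R P h s (hπ1 h s) (hX h s hq) v⟩

/-- The mixed actions available in the belief set at stage `h` and state `s`. -/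
def beliefActions {S : Type} {m K : ℕ} (base : Fin K → ℕ → S → Fin m → ℝ) (h : ℕ) (s : S) :
    Set (Fin m → ℝ) :=
  {q | ∃ p ∈ stdSimplex ℝ (Fin K), ∀ a2, q a2 = ∑ k, p k * base k h s a2}

lemma beliefActions_nonempty {S : Type} {m K : ℕ} (hK : 0 < K)
    (base : Fin K → ℕ → S → Fin m → ℝ) (h : ℕ) (s : S) : (beliefActions base h s).Nonempty :=
  ⟨fun a2 => ∑ k, (Pi.single ⟨0, hK⟩ 1 : Fin K → ℝ) k * base k h s a2,
    (Pi.single ⟨0, hK⟩ 1 : Fin K → ℝ), single_mem_stdSimplex ℝ _, fun _ => rfl⟩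

lemma beliefActions_subset_stdSimplex {S : Type} {m K : ℕ}
    {base : Fin K → ℕ → S → Fin m → ℝ} (hbase : ∀ k, base k ∈ polSet S m) (h : ℕ) (s : S) :
    beliefActions base h s ⊆ stdSimplex ℝ (Fin m) := by
  rintro q ⟨p, hp, hq⟩
  refine ⟨fun a2 => ?_, ?_⟩
  · rw [hq]
    exact sum_nonneg fun k _ => mul_nonneg (hp.1 k) ((hbase k h s).1 a2)
  · simp only [hq]
    rw [sum_comm]
    simp only [← mul_sum, (hbase _ h s).2, mul_one]
    exact hp.2

lemma sInf_Vfun_beliefSet {S : Type} [Fintype S] {n m K H : ℕ} (hK : 0 < K)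
    (R : ℕ → S → Fin n → Fin m → ℝ) {P : ℕ → S → Fin n → Fin m → S → ℝ} (hP : isKernel S P)
    {base : Fin K → ℕ → S → Fin m → ℝ} (hbase : ∀ k, base k ∈ polSet S m)
    {π1 : ℕ → S → Fin n → ℝ} (hπ1 : π1 ∈ polSet S n) {h : ℕ} (h1 : 1 ≤ h) (s : S) :
    sInf ((fun π2 => Vfun H R P π1 π2 h s) '' beliefSet S base)
      = robustVal (fun h s q v => bellman R P h s (π1 h s) q v) H (beliefActions base)
          (H + 1 - h) s := by
  rw [← sInf_policyVal_eq_robustVal (isRobustOperator_right R hP hπ1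
    (beliefActions_nonempty hK base) (beliefActions_subset_stdSimplex hbase)) (by omega) s]
  simp only [Vfun, valAux_eq_policyVal_right]
  rfl

/-- Pasting together, state by state and stage by stage, policies of `Π₁*` stays in `Π₁*`. -/
lemma mem_Pi1starSet_of_forall_exists {S : Type} [Fintype S] {n m K H : ℕ} (hK : 0 < K)
    {R : ℕ → S → Fin n → Fin m → ℝ} {P : ℕ → S → Fin n → Fin m → S → ℝ} (hP : isKernel S P)
    {base : Fin K → ℕ → S → Fin m → ℝ} (hbase : ∀ k, base k ∈ polSet S m)
    (hne : (Pi1starSet H R P base).Nonempty) {x : ℕ → S → Fin n → ℝ}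
    (hx : ∀ h s, ∃ π ∈ Pi1starSet H R P base, π h s = x h s) :
    x ∈ Pi1starSet H R P base := by
  have hxpol : x ∈ polSet S n := by
    intro h s
    obtain ⟨π, hπ, heq⟩ := hx h s
    exact heq ▸ hπ.1 h s
  have key : ∀ t ≤ H, ∀ π ∈ Pi1starSet H R P base,
      robustVal (fun h s q v => bellman R P h s (x h s) q v) H (beliefActions base) t
        = robustVal (fun h s q v => bellman R P h s (π h s) q v) H (beliefActions base) t := by
    intro t
    induction t with
    | zero => intros; rfl
    | succ t ih =>
      intro ht π hπ
      funext s
      obtain ⟨ρ, hρ, heq⟩ := hx (H - t) s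
      have hval : ∀ π ∈ Pi1starSet H R P base,
          robustVal (fun h s q v => bellman R P h s (π h s) q v) H (beliefActions base) (t + 1) s
            = Vstar1 H R P base (H - t) s := by
        intro π hπ
        rw [← hπ.2 (H - t) (by omega) (by omega) s,
          sInf_Vfun_beliefSet hK R hP hbase hπ.1 (by omega) s,
          show H + 1 - (H - t) = t + 1 by omega]
      rw [hval π hπ, ← hval ρ hρ]
      simp only [robustVal, ← heq, ih (by omega) ρ hρ]
  refine ⟨hxpol, fun h h1 hH s => ?_⟩
  obtain ⟨π, hπ⟩ := hne
  rw [← hπ.2 h h1 hH s, sInf_Vfun_beliefSet hK R hP hbase hxpol h1 s,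
    sInf_Vfun_beliefSet hK R hP hbase hπ.1 h1 s, key _ (by omega) π hπ]

lemma exists_isMaxOn_sInf_bellman {S : Type} [Fintype S] {n m : ℕ} (hm : 0 < m)
    (R : ℕ → S → Fin n → Fin m → ℝ) (P : ℕ → S → Fin n → Fin m → S → ℝ)
    {X : Set (Fin n → ℝ)} (hne : X.Nonempty) (hX : X ⊆ stdSimplex ℝ (Fin n))
    (h : ℕ) (s : S) (v : S → ℝ) :
    ∃ q ∈ stdSimplex ℝ (Fin m), IsMaxOn
      (fun q => sInf ((fun p => bellman R P h s p q v) '' X)) (stdSimplex ℝ (Fin m)) q := by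
  have : Nonempty X := hne.to_subtype
  refine UpperSemicontinuousOn.exists_isMaxOn
    ⟨_, single_mem_stdSimplex ℝ (⟨0, hm⟩ : Fin m)⟩ (isCompact_stdSimplex ℝ (Fin m)) ?_
  simp only [sInf_image']
  refine upperSemicontinuousOn_ciInf (fun q hq => ⟨_, Set.forall_mem_range.2 fun p =>
    neg_sum_abs_le_bellman R P h s (hX p.2) hq v⟩) fun p =>
    (continuous_bellman_right R P h s p v).upperSemicontinuous.upperSemicontinuousOn _

/-- Against a maximizing player choosing `q` in the simplex, a stagewise maximin policy attains
the largest worst-case value at all stages and states simultaneously. -/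
lemma exists_forall_robustVal_le {S : Type} [Fintype S] {n m : ℕ} (hm : 0 < m) (H : ℕ)
    (R : ℕ → S → Fin n → Fin m → ℝ) {P : ℕ → S → Fin n → Fin m → S → ℝ} (hP : isKernel S P)
    {X : ℕ → S → Set (Fin n → ℝ)} (hne : ∀ h s, (X h s).Nonempty)
    (hX : ∀ h s, X h s ⊆ stdSimplex ℝ (Fin n)) :
    ∃ σ ∈ polSet S m, ∀ π2 ∈ polSet S m, ∀ t ≤ H,
      robustVal (fun h s p v => bellman R P h s p (π2 h s) v) H X t
        ≤ robustVal (fun h s p v => bellman R P h s p (σ h s) v) H X t := by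
  choose q hq hmax using fun h s v =>
    exists_isMaxOn_sInf_bellman hm R P (hne h s) (hX h s) h s v
  let U : ℕ → S → ℝ := fun t => t.rec (fun _ => 0) fun t u s =>
    sInf ((fun p => bellman R P (H - t) s p (q (H - t) s u) u) '' X (H - t) s)
  refine ⟨fun h s => q h s (U (H - h)), fun h s => hq _ _ _, fun π2 hπ2 => ?_⟩
  have hU : ∀ t ≤ H, robustVal
      (fun h s p v => bellman R P h s p (q h s (U (H - h))) v) H X t = U t := by
    intro t
    induction t with
    | zero => intro; rfl
    | succ t ih =>
      intro ht
      funext s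
      simp only [robustVal, ih (by omega), show H - (H - t) = t by omega]
      rfl
  intro t
  induction t with
  | zero => exact fun _ s => le_rfl
  | succ t ih =>
    intro ht s
    have ih' := ih (by omega)
    rw [hU t (by omega)] at ih'
    rw [hU (t + 1) ht]
    refine le_trans ?_ (hmax (H - t) s (U t) (hπ2 (H - t) s))
    have hT := isRobustOperator_left R hP hπ2 hne hX
    refine le_csInf ((hne _ _).image _) ?_
    rintro _ ⟨p, hp, rfl⟩
    exact (csInf_le (hT.bddBelow _ _ _) ⟨p, hp, rfl⟩).trans (hT.mono _ _ p hp _ _ ih')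

/-- attainment of the attacker's worst-case optimum by a Markov policy:
there is an attacker Markov policy `π₂*` such that simultaneously for every `h ∈ [H]`
and `s ∈ S`, `min_{π₁∈Π₁*} V^{π₁,π₂*}_{2,h}(s) = V*_{2,h}(s)`. -/
theorem stmt10 {S : Type} [Fintype S] {n m K H : ℕ} (hn : 0 < n) (hm : 0 < m) (hK : 0 < K)
    (R1 R2 : ℕ → S → Fin n → Fin m → ℝ)
    (P : ℕ → S → Fin n → Fin m → S → ℝ) (hP : isKernel S P)
    (base : Fin K → ℕ → S → Fin m → ℝ) (hbase : ∀ k, base k ∈ polSet S m) :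
    ∃ π2star ∈ polSet S m, ∀ h : ℕ, 1 ≤ h → h ≤ H → ∀ s : S,
      sInf ((fun π1 => Vfun H R2 P π1 π2star h s) '' Pi1starSet H R1 P base)
        = Vstar2 H R1 R2 P base h s := by
  rcases (Pi1starSet H R1 P base).eq_empty_or_nonempty with hem | hne
  · have hpol : (polSet S m).Nonempty :=
      ⟨fun _ _ => Pi.single ⟨0, hm⟩ 1, fun _ _ => single_mem_stdSimplex ℝ _⟩
    obtain ⟨σ, hσ⟩ := id hpol
    refine ⟨σ, hσ, fun h _ _ s => ?_⟩
    simp [Vstar2, hem, hpol.image_const]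
  · let X : ℕ → S → Set (Fin n → ℝ) := fun h s => (fun π => π h s) '' Pi1starSet H R1 P base
    have hXne : ∀ h s, (X h s).Nonempty := fun h s => hne.image _
    have hX : ∀ h s, X h s ⊆ stdSimplex ℝ (Fin n) := by
      rintro h s _ ⟨π, hπ, rfl⟩
      exact hπ.1 h s
    have hset : Pi1starSet H R1 P base = {x | ∀ h s, x h s ∈ X h s} :=
      Set.Subset.antisymm (fun π hπ h s => ⟨π, hπ, rfl⟩)
        fun x hx => mem_Pi1starSet_of_forall_exists hK hP hbase hne hx
    have hval : ∀ π2 ∈ polSet S m, ∀ h : ℕ, 1 ≤ h → ∀ s : S,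
        sInf ((fun π1 => Vfun H R2 P π1 π2 h s) '' Pi1starSet H R1 P base)
          = robustVal (fun h s p v => bellman R2 P h s p (π2 h s) v) H X (H + 1 - h) s := by
      intro π2 hπ2 h h1 s
      rw [← sInf_policyVal_eq_robustVal (isRobustOperator_left R2 hP hπ2 hXne hX) (by omega) s,
        hset]
      simp only [Vfun, valAux_eq_policyVal_left]
    obtain ⟨σ, hσ, hle⟩ := exists_forall_robustVal_le hm H R2 hP hXne hX
    refine ⟨σ, hσ, fun h h1 hH s => ?_⟩
    symm
    apply IsGreatest.csSup_eq
    refine ⟨⟨σ, hσ, rfl⟩, ?_⟩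
    rintro _ ⟨π2, hπ2, rfl⟩
    simp only [hval _ hπ2 h h1, hval _ hσ h h1]
    exact hle π2 hπ2 _ (by omega) s
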